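/- arXiv:1508.02068 — 3 statements merged into one kernel-verified Lean document; each statement's English description precedes it below -/
import Mathlib

section
/- (Truncated complex moment problem.) Let n > 1, d_K := max_{1≤i≤m} k_i, and y ∈ H_d with d ≥ d_K. Assume the constraints defining K include, for each k = 1,…,n, a constraint |z_k|² ≤ R_k² or |z_k|² = R_k² for some R_k ≥ 0, or include a single constraint Σ_{k=1}^n |z_k|² ≤ R² or Σ_{k=1}^n |z_k|² = R² for some R ≥ 0. Then there exists a positive measure μ = Σ_{j=1}^r λ_j δ_{z(j)} with exactly r = rank M_{d−d_K}(y) distinct atoms z(1),…,z(r) ∈ K and weights λ_j > 0 such that y_{α,β} = ∫ z̄^α z^β dμ for all |α|,|β| ≤ d, if and only if the following three conditions hold: (1) M_d(y) ⪰ 0 and M_{d−k_i}(g_i y) ⪰ 0 for i = 1,…,m; (2) rank M_d(y) = rank M_{d−d_K}(y); (3) for all 1 ≤ i < j ≤ n, the 3×3 block matrix [[M_{d−d_K}(y), M_{d−d_K}(z̄_i y), M_{d−d_K}(z̄_j y)],[M_{d−d_K}(z_i y), M_{d−d_K}(|z_i|² y), M_{d−d_K}(z̄_j z_i y)],[M_{d−d_K}(z_j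 y), M_{d−d_K}(z̄_i z_j y), M_{d−d_K}(|z_j|² y)]] is positive semidefinite. Moreover, in that case, for each 1 ≤ i ≤ m the measure μ has exactly rank M_d(y) − rank M_{d−d_K}(g_i y) atoms that are zeros of g_i. -/
open scoped BigOperators ComplexOrder
open Classical Filter

noncomputable section

/-- Multi-indices in `ℕⁿ`. -/
abbrev MIdx (n : ℕ) := Fin n → ℕ

/-- `|α| = α₁ + ⋯ + αₙ`. -/
def mdeg {n : ℕ} (α : MIdx n) : ℕ := ∑ i, α i

/-- The monomial `z^α := z₁^{α₁} ⋯ zₙ^{αₙ}`. -/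
def mpow {n : ℕ} (z : Fin n → ℂ) (α : MIdx n) : ℂ := ∏ i, z i ^ α i

/-- Evaluation of the coefficient array `c` as the (real part of the) complex
polynomial `z ↦ Σ_{α,β} c_{α,β} z̄^α z^β`. -/
def peval {n : ℕ} (c : MIdx n → MIdx n → ℂ) (z : Fin n → ℂ) : ℝ :=
  (∑ᶠ α : MIdx n, ∑ᶠ β : MIdx n, c α β * (starRingEnd ℂ) (mpow z α) * mpow z β).re

/-- Evaluation of a holomorphic polynomial with coefficients `p`. -/
def hpeval {n : ℕ} (p : MIdx n → ℂ) (z : Fin n → ℂ) : ℂ :=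
  ∑ᶠ α : MIdx n, p α * mpow z α

/-- `σ ∈ Σ_d[z]`: `σ` is a finite sum of squared moduli of holomorphic polynomials
of degree at most `d`. -/
def IsSOSUpTo {n : ℕ} (d : ℕ) (σ : (Fin n → ℂ) → ℝ) : Prop :=
  ∃ (r : ℕ) (p : Fin r → MIdx n → ℂ),
    (∀ j α, p j α ≠ 0 → mdeg α ≤ d) ∧
    ∀ z, σ z = ∑ j, Complex.normSq (hpeval (p j) z)

/-- `σ ∈ Σ[z]`. -/
def IsSOS {n : ℕ} (σ : (Fin n → ℂ) → ℝ) : Prop := ∃ d, IsSOSUpTo d σ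

/-- Hermitian coefficient array of degree at most `l` (real-valued complex polynomial). -/
def IsPolyDeg {n : ℕ} (l : ℕ) (c : MIdx n → MIdx n → ℂ) : Prop :=
  (∀ α β, c α β ≠ 0 → mdeg α ≤ l ∧ mdeg β ≤ l) ∧
  (∀ α β, (starRingEnd ℂ) (c α β) = c β α)

/-- `c` has a nonzero coefficient `c_{α,β}` with `|α| = l` (degree exactly `l`). -/
def HasTopDeg {n : ℕ} (l : ℕ) (c : MIdx n → MIdx n → ℂ) : Prop :=
  ∃ α β, mdeg α = l ∧ mdeg β ≤ l ∧ c α β ≠ 0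

/-- Multi-indices of degree at most `e`, indexing moment matrices. -/
def Idx (n e : ℕ) := {α : MIdx n // mdeg α ≤ e}

noncomputable instance {n e : ℕ} : Fintype (Idx n e) :=
  Fintype.ofInjective
    (fun a : Idx n e => (fun i =>
      (⟨a.1 i, Nat.lt_succ_of_le (le_trans
        (Finset.single_le_sum (f := a.1) (fun j _ => Nat.zero_le _) (Finset.mem_univ i))
        a.2)⟩ : Fin (e + 1)) : Fin n → Fin (e + 1)))
    (fun a b h => Subtype.ext (funext fun i => congrArg Fin.val (congrFun h i)))

/-- Entry `(α,β)` of the localizing matrix `M(φ y)`: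
`Σ_{γ,δ} φ_{γ,δ} y_{α+γ, β+δ}`. -/
def momEntry {n : ℕ} (φ y : MIdx n → MIdx n → ℂ) (α β : MIdx n) : ℂ :=
  ∑ᶠ γ : MIdx n, ∑ᶠ δ : MIdx n, φ γ δ * y (α + γ) (β + δ)

/-- The localizing matrix `M_e(φ y)` indexed by multi-indices of degree at most `e`. -/
def momMatrix (n e : ℕ) (φ y : MIdx n → MIdx n → ℂ) :
    Matrix (Idx n e) (Idx n e) ℂ :=
  Matrix.of fun a b => momEntry φ y a.1 b.1

/-- The moment matrix `M_e(y)` indexed by multi-indices of degree at most `e`. -/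
def momMatrixId (n e : ℕ) (y : MIdx n → MIdx n → ℂ) :
    Matrix (Idx n e) (Idx n e) ℂ :=
  Matrix.of fun a b => y a.1 b.1

/-- The Riesz functional `L_y(c) = Σ_{α,β} c_{α,β} y_{α,β}` (real part). -/
def Ly {n : ℕ} (c y : MIdx n → MIdx n → ℂ) : ℝ :=
  (∑ᶠ α : MIdx n, ∑ᶠ β : MIdx n, c α β * y α β).re

/-- `y ∈ H_d`: hermitian array truncated at degree `d`. -/
def HermArr (n d : ℕ) (y : MIdx n → MIdx n → ℂ) : Prop :=
  ∀ α β : MIdx n, mdeg α ≤ d → mdeg β ≤ d → (starRingEnd ℂ) (y α β) = y β α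

/-- The feasible set `K = {z : g_i(z) ≥ 0, i = 1,…,m}`. -/
def Kset {n m : ℕ} (g : Fin m → MIdx n → MIdx n → ℂ) : Set (Fin n → ℂ) :=
  {z | ∀ i, 0 ≤ peval (g i) z}

/-- Coefficients of the polynomial `s(z) = R² − |z₁|² − ⋯ − |zₙ|²`. -/
def spherePoly (n : ℕ) (R : ℝ) : MIdx n → MIdx n → ℂ := fun α β =>
  if α = 0 ∧ β = 0 then ((R ^ 2 : ℝ) : ℂ)
  else if ∃ i : Fin n, α = Pi.single i 1 ∧ β = Pi.single i 1 then -1 else 0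

/-- Feasibility for the complex moment relaxation of order `d`. -/
def MomFeas (n m d : ℕ) (g : Fin m → MIdx n → MIdx n → ℂ) (kk : Fin m → ℕ)
    (y : MIdx n → MIdx n → ℂ) : Prop :=
  HermArr n d y ∧ y 0 0 = 1 ∧ (momMatrixId n d y).PosSemidef ∧
    ∀ i, (momMatrix n (d - kk i) (g i) y).PosSemidef

/-- `ρ_d`: optimal value of the complex moment relaxation of order `d`. -/
def rhoMom (n m d : ℕ) (f : MIdx n → MIdx n → ℂ) (g : Fin m → MIdx n → MIdx n → ℂ)
    (kk : Fin m → ℕ) : EReal :=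
  sInf {x : EReal | ∃ y, MomFeas n m d g kk y ∧ x = ((Ly f y : ℝ) : EReal)}

/-- A degree-`d` sum-of-squares certificate `f − λ = Σ_{i=0}^m σ_i g_i`. -/
def SOSCert (n m d : ℕ) (f : MIdx n → MIdx n → ℂ) (g : Fin m → MIdx n → MIdx n → ℂ)
    (kk : Fin m → ℕ) (lam : ℝ) : Prop :=
  ∃ (σ0 : (Fin n → ℂ) → ℝ) (σ : Fin m → (Fin n → ℂ) → ℝ),
    IsSOSUpTo d σ0 ∧ (∀ i, IsSOSUpTo (d - kk i) (σ i)) ∧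
    ∀ z, peval f z - lam = σ0 z + ∑ i, σ i z * peval (g i) z

/-- `ρ_d*`: optimal value of the complex sum-of-squares relaxation of order `d`. -/
def rhoSOS (n m d : ℕ) (f : MIdx n → MIdx n → ℂ) (g : Fin m → MIdx n → MIdx n → ℂ)
    (kk : Fin m → ℕ) : EReal :=
  sSup {x : EReal | ∃ lam : ℝ, SOSCert n m d f g kk lam ∧ x = ((lam : ℝ) : EReal)}

/-- `f^opt = inf_K f` as an extended real number. -/
def fOpt (n m : ℕ) (f : MIdx n → MIdx n → ℂ) (g : Fin m → MIdx n → MIdx n → ℂ) : EReal :=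
  sInf {x : EReal | ∃ z ∈ Kset g, x = ((peval f z : ℝ) : EReal)}

/-- Sphere assumption: two of the constraint polynomials are `s` and `−s` where
`s(z) = R² − |z₁|² − ⋯ − |zₙ|²`. -/
def SphereAssumption (n m : ℕ) (g : Fin m → MIdx n → MIdx n → ℂ) (R : ℝ) : Prop :=
  0 < R ∧ ∃ i₁ i₂ : Fin m, i₁ ≠ i₂ ∧ g i₁ = spherePoly n R ∧
    (∀ α β, g i₂ α β = -(spherePoly n R α β))

/-- Coefficients of the polynomial `R² − |z_j|²`. -/
def coordPoly (n : ℕ) (j : Fin n) (R : ℝ) : MIdx n → MIdx n → ℂ := fun α β =>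
  if α = 0 ∧ β = 0 then ((R ^ 2 : ℝ) : ℂ)
  else if α = Pi.single j 1 ∧ β = Pi.single j 1 then -1 else 0

/-- The 3×3 block matrix
`[[M_e(y), M_e(z̄_i y), M_e(z̄_j y)],
  [M_e(z_i y), M_e(|z_i|² y), M_e(z̄_j z_i y)],
  [M_e(z_j y), M_e(z̄_i z_j y), M_e(|z_j|² y)]]`. -/
def locMat3 (n e : ℕ) (y : MIdx n → MIdx n → ℂ) (i j : Fin n) :
    Matrix (Fin 3 × Idx n e) (Fin 3 × Idx n e) ℂ :=
  Matrix.of fun a b =>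
    y (a.2.1 + ![0, Pi.single i 1, Pi.single j 1] b.1)
      (b.2.1 + ![0, Pi.single i 1, Pi.single j 1] a.1)

/-- `y` (truncated at degree `d`) is represented by the finite atomic measure with
distinct atoms `zs j ∈ K` and positive weights `lam j`. -/
def AtomicRep (n m d : ℕ) (g : Fin m → MIdx n → MIdx n → ℂ)
    (y : MIdx n → MIdx n → ℂ) {r : ℕ} (zs : Fin r → (Fin n → ℂ)) (lam : Fin r → ℝ) : Prop :=
  Function.Injective zs ∧ (∀ j, zs j ∈ Kset g) ∧ (∀ j, 0 < lam j) ∧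
  ∀ α β : MIdx n, mdeg α ≤ d → mdeg β ≤ d →
    y α β = ∑ j, (lam j : ℂ) * (starRingEnd ℂ) (mpow (zs j) α) * mpow (zs j) β


section ops
variable {W : Type*} [NormedAddCommGroup W] [InnerProductSpace ℂ W] [FiniteDimensional ℂ W]

lemma pos_trace_zero (D : W →ₗ[ℂ] W) (hD : D.IsPositive) (ht : LinearMap.trace ℂ W D = 0) : D = 0 := by
  have hs := hD.isSymmetric
  have h1 := hs.trace_eq_sum_eigenvalues rfl
  rw [ht] at h1
  have h2 : ∑ i, hs.eigenvalues rfl i = 0 := by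
    have : ((∑ i, hs.eigenvalues rfl i : ℝ) : ℂ) = 0 := by
      rw [h1]; simp
    exact_mod_cast this
  have h3 : ∀ i, 0 ≤ hs.eigenvalues rfl i := fun i => hD.nonneg_eigenvalues rfl i
  have h4 := (Finset.sum_eq_zero_iff_of_nonneg (fun i _ => h3 i)).1 h2
  apply (hs.eigenvectorBasis rfl).toBasis.ext
  intro i
  simp [hs.apply_eigenvectorBasis, h4 i (Finset.mem_univ i)]

open LinearMap in
lemma normal_of_hypo (T : W →ₗ[ℂ] W) (h : ∀ x, ‖adjoint T x‖ ≤ ‖T x‖) :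
    adjoint T * T = T * adjoint T := by
  have : adjoint T * T - T * adjoint T = 0 := by
    apply pos_trace_zero
    · constructor
      · have h1 : (adjoint T * T).IsSymmetric := (isPositive_adjoint_comp_self T).isSymmetric
        have h2 : (T * adjoint T).IsSymmetric := (isPositive_self_comp_adjoint T).isSymmetric
        exact h1.sub h2
      · intro x
        simp only [LinearMap.sub_apply, Module.End.mul_apply, inner_sub_left, adjoint_inner_left, map_sub]
        rw [← adjoint_inner_right T (adjoint T x)]
        rw [inner_self_eq_norm_sq, inner_self_eq_norm_sq]
        have := h x
        have := norm_nonneg (adjoint T x)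
        nlinarith
    · rw [map_sub, trace_mul_comm, sub_self]
  exact sub_eq_zero.1 this

open LinearMap in
lemma fug (A N : W →ₗ[ℂ] W) (hN : adjoint N * N = N * adjoint N)
    (hAN : A * adjoint N = adjoint N * A) : A * N = N * A := by
  have h0 : N * adjoint A = adjoint A * N := by
    have := congrArg adjoint hAN
    simpa [Module.End.mul_eq_comp, adjoint_comp] using this
  set X := A * N - N * A with hX
  have hXa : adjoint X = adjoint N * adjoint A - adjoint A * adjoint N := by
    simp [hX, Module.End.mul_eq_comp, adjoint_comp]
  have h1 : adjoint X * X = 0 := by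
    apply pos_trace_zero
    · exact isPositive_adjoint_comp_self X
    · rw [hXa, hX]
      have e : (adjoint N * adjoint A - adjoint A * adjoint N) * (A * N - N * A) =
         adjoint N * (adjoint A * A * N) - adjoint N * N * (adjoint A * A)
          - adjoint A * A * (adjoint N * N) + N * (adjoint A * A * adjoint N) := by
        have e1 : adjoint N * (adjoint A * (N * A)) = adjoint N * (N * (adjoint A * A)) := by
          rw [← mul_assoc (adjoint A), ← h0]; simp only [mul_assoc]
        have e2 : adjoint A * (adjoint N * (A * N)) = adjoint A * (A * (adjoint N * N)) := by
          rw [← mul_assoc (adjoint N), ← hAN]; simp only [mul_assoc]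
        have e3 : adjoint A * (adjoint N * (N * A)) = N * (adjoint A * (A * adjoint N)) := by
          rw [← mul_assoc (adjoint N), hN, mul_assoc, ← mul_assoc, ← h0, ← hAN, mul_assoc]
        simp only [sub_mul, mul_sub, mul_assoc, e1, e2, e3]
        abel
      rw [e]
      simp only [map_add, map_sub]
      rw [trace_mul_comm ℂ (adjoint N), trace_mul_comm ℂ (adjoint N * N), trace_mul_comm ℂ N]
      simp only [mul_assoc]
      rw [hN]
      abel
  have h2 : ∀ x, X x = 0 := by
    intro x
    have : inner ℂ (X x) (X x) = 0 := by
      rw [← adjoint_inner_right]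
      have := congrArg (fun f => f x) h1
      simp only [Module.End.mul_apply] at this
      rw [this]; simp
    exact inner_self_eq_zero.1 this
  have : X = 0 := LinearMap.ext h2
  exact sub_eq_zero.1 this

open LinearMap in
/-- the 3x3 operator condition gives normality and commutation -/
lemma block_cond (A B : W →ₗ[ℂ] W)
    (h : ∀ x0 x1 x2 : W, 0 ≤ (inner ℂ x0 x0 + inner ℂ (A x0) x1 + inner ℂ (B x0) x2
      + inner ℂ x1 (A x0) + inner ℂ x2 (B x0)
      + inner ℂ (A x1) (A x1) + inner ℂ (B x1) (A x2) + inner ℂ (A x2) (B x1)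
      + inner ℂ (B x2) (B x2)).re) :
    adjoint A * A = A * adjoint A ∧ adjoint B * B = B * adjoint B ∧
      adjoint B * A = A * adjoint B := by
  have key : ∀ x1 x2 : W, 0 ≤ ‖A x1‖^2 + ‖B x2‖^2 + 2 * (inner ℂ (B x1) (A x2)).re
      - ‖adjoint A x1 + adjoint B x2‖^2 := by
    intro x1 x2
    have := h (-(adjoint A x1 + adjoint B x2)) x1 x2
    set v := adjoint A x1 + adjoint B x2 with hv
    have e1 : inner ℂ (A (-v)) x1 + inner ℂ (B (-v)) x2 = - inner ℂ v v := by
      rw [← adjoint_inner_right A, ← adjoint_inner_right B, ← inner_add_right, ← hv, inner_neg_left]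
    have e2 : inner ℂ x1 (A (-v)) + inner ℂ x2 (B (-v)) = - inner ℂ v v := by
      rw [← adjoint_inner_left A, ← adjoint_inner_left B, ← inner_add_left, ← hv, inner_neg_right]
    have e3 : (inner ℂ (A x2) (B x1)).re = (inner ℂ (B x1) (A x2)).re := by
      rw [← inner_conj_symm (A x2) (B x1), Complex.conj_re]
    have e4 : ∀ w : W, (inner ℂ w w : ℂ).re = ‖w‖^2 := fun w => by
      exact inner_self_eq_norm_sq (𝕜 := ℂ) w
    have e1' := congrArg Complex.re e1
    have e2' := congrArg Complex.re e2
    simp only [Complex.add_re, Complex.neg_re, e4, norm_neg] at this e1' e2'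
    linarith
  have hA := normal_of_hypo A (fun x => by
    have := key x 0
    simp at this
    exact (sq_le_sq₀ (norm_nonneg _) (norm_nonneg _)).1 this)
  have hB := normal_of_hypo B (fun x => by
    have := key 0 x
    simp at this
    exact (sq_le_sq₀ (norm_nonneg _) (norm_nonneg _)).1 this)
  refine ⟨hA, hB, ?_⟩
  have nrm : ∀ T : W →ₗ[ℂ] W, adjoint T * T = T * adjoint T → ∀ x, ‖adjoint T x‖^2 = ‖T x‖^2 := by
    intro T hT x
    have : inner ℂ (adjoint T x) (adjoint T x) = inner ℂ (T x) (T x) := by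
      rw [adjoint_inner_left, ← adjoint_inner_right T x (T x)]
      have := congrArg (fun f => f x) hT
      simp only [Module.End.mul_apply] at this
      rw [this]
    rw [inner_self_eq_norm_sq_to_K, inner_self_eq_norm_sq_to_K] at this
    exact_mod_cast this
  have key2 : ∀ x1 x2 : W, 0 ≤ (inner ℂ x1 ((adjoint B * A - A * adjoint B) x2)).re := by
    intro x1 x2
    have := key x1 x2
    have e := norm_add_sq (𝕜 := ℂ) (adjoint A x1) (adjoint B x2)
    rw [e, nrm A hA, nrm B hB] at this
    simp only [LinearMap.sub_apply, Module.End.mul_apply, inner_sub_right, adjoint_inner_right, Complex.sub_re]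
    rw [adjoint_inner_left] at this
    have e' : RCLike.re (inner ℂ x1 (A (adjoint B x2))) = (inner ℂ x1 (A (adjoint B x2))).re := rfl
    rw [e'] at this
    linarith
  have : adjoint B * A - A * adjoint B = 0 := by
    apply LinearMap.ext
    intro x
    have := key2 (-((adjoint B * A - A * adjoint B) x)) x
    rw [inner_neg_left] at this
    have e4 : ∀ w : W, (inner ℂ w w : ℂ).re = ‖w‖^2 := fun w => by
      exact inner_self_eq_norm_sq (𝕜 := ℂ) w
    rw [Complex.neg_re, e4] at this
    have h0 : ‖(adjoint B * A - A * adjoint B) x‖ = 0 := by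
      have := sq_nonneg ‖(adjoint B * A - A * adjoint B) x‖
      apply pow_eq_zero_iff (two_ne_zero) |>.1; linarith
    simpa using h0
  exact sub_eq_zero.1 this
end ops

section joint
variable {W : Type*} [NormedAddCommGroup W] [InnerProductSpace ℂ W] [FiniteDimensional ℂ W]

open LinearMap in
lemma joint_diag {n : ℕ} (T : Fin n → W →ₗ[ℂ] W)
    (hN : ∀ i j, adjoint (T j) * T i = T i * adjoint (T j))
    (hC : ∀ i j, T i * T j = T j * T i) (u0 : W) :
    ∃ (ι : Type) (_ : Fintype ι) (z : ι → (Fin n → ℂ)) (w : ι → W),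
      Function.Injective z ∧ (∀ k, w k ≠ 0) ∧ (∀ k i, T i (w k) = z k i • w k) ∧
      (∀ k l, k ≠ l → inner ℂ (w k) (w l) = 0) ∧ u0 = ∑ k, w k := by
  let F : Fin n × Bool → W →ₗ[ℂ] W := fun p =>
    if p.2 then T p.1 + adjoint (T p.1) else Complex.I • (T p.1 - adjoint (T p.1))
  have hC' : ∀ i j, adjoint (T i) * adjoint (T j) = adjoint (T j) * adjoint (T i) := by
    intro i j
    have := congrArg adjoint (hC j i)
    simpa [Module.End.mul_eq_comp, adjoint_comp] using this
  have hF : ∀ p, (F p).IsSymmetric := by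
    rintro ⟨i, b⟩
    rw [isSymmetric_iff_isSelfAdjoint, isSelfAdjoint_iff, star_eq_adjoint]
    cases b
    · simp only [F, Bool.false_eq_true, if_false]
      rw [map_smulₛₗ, map_sub, adjoint_adjoint, Complex.conj_I, neg_smul, ← smul_neg, neg_sub]
    · simp [F, add_comm]
  have hcomm : Pairwise (Function.onFun Commute F) := by
    rintro ⟨i, b⟩ ⟨j, c⟩ -
    have c1 : Commute (T i) (T j) := hC i j
    have c2 : Commute (adjoint (T i)) (adjoint (T j)) := hC' i j
    have c3 : Commute (adjoint (T i)) (T j) := hN j i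
    have c4 : Commute (T i) (adjoint (T j)) := (hN i j).symm
    have c5 : Commute (T i + adjoint (T i)) (T j) := c1.add_left c3
    have c6 : Commute (T i + adjoint (T i)) (adjoint (T j)) := c4.add_left c2
    have c7 : Commute (T i - adjoint (T i)) (T j) := c1.sub_left c3
    have c8 : Commute (T i - adjoint (T i)) (adjoint (T j)) := c4.sub_left c2
    simp only [Function.onFun, F]
    cases b <;> cases c
    · exact ((c7.sub_right c8).smul_left _).smul_right _
    · exact ((c7.add_right c8).smul_left _)
    · exact ((c5.sub_right c6).smul_right _)
    · exact ((c5.add_right c6))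
  have htop := LinearMap.IsSymmetric.iSup_iInf_eq_top_of_commute hF hcomm
  have horth := LinearMap.IsSymmetric.orthogonalFamily_iInf_eigenspaces hF
  have hu : u0 ∈ ⨆ χ : Fin n × Bool → ℂ, ⨅ i, Module.End.eigenspace (F i) (χ i) := by
    rw [htop]; trivial
  rw [Submodule.mem_iSup_iff_exists_finsupp] at hu
  obtain ⟨f, hf, hsum⟩ := hu
  have heig : ∀ χ p, F p (f χ) = χ p • f χ := by
    intro χ p
    exact Module.End.mem_eigenspace_iff.1 ((Submodule.mem_iInf _).1 (hf χ) p)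
  have hreal : ∀ χ, f χ ≠ 0 → ∀ p, (starRingEnd ℂ) (χ p) = χ p := by
    intro χ h p
    apply (hF p).conj_eigenvalue_eq_self
    exact Module.End.hasEigenvalue_of_hasEigenvector
      ⟨Module.End.mem_eigenspace_iff.2 (heig χ p), h⟩
  refine ⟨{χ // χ ∈ f.support}, inferInstance,
    fun k i => (k.1 (i, true) - Complex.I * k.1 (i, false)) / 2, fun k => f k.1, ?_, ?_, ?_, ?_, ?_⟩
  · rintro ⟨χ, hχ⟩ ⟨ψ, hψ⟩ h
    have r1 := hreal χ (by simpa using hχ)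
    have r2 := hreal ψ (by simpa using hψ)
    apply Subtype.ext
    funext ⟨i, b⟩
    have h' := congrFun h i
    simp only at h'
    have h'' := congrArg (starRingEnd ℂ) h'
    simp only [map_div₀, map_sub, map_mul, r1, r2, Complex.conj_I, map_ofNat] at h''
    show χ (i, b) = ψ (i, b)
    cases b
    · have : Complex.I * χ (i, false) = Complex.I * ψ (i, false) := by linear_combination h'' - h'
      exact mul_left_cancel₀ Complex.I_ne_zero this
    · linear_combination h'' + h'
  · rintro ⟨χ, hχ⟩
    simpa using hχ
  · rintro ⟨χ, hχ⟩ i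
    have h1 := heig χ (i, true)
    have h2 := heig χ (i, false)
    simp only [F, if_true, Bool.false_eq_true, if_false, LinearMap.add_apply, LinearMap.sub_apply,
      LinearMap.smul_apply] at h1 h2
    have : (2:ℂ) • T i (f χ) = (2:ℂ) • (((χ (i, true) - Complex.I * χ (i, false)) / 2) • f χ) := by
      rw [smul_smul, mul_div_cancel₀ _ (two_ne_zero), sub_smul, mul_smul, ← h1, ← h2, smul_smul,
        Complex.I_mul_I, two_smul]
      simp only [neg_smul, one_smul]
      abel
    exact smul_right_injective W (two_ne_zero (α := ℂ)) this
  · rintro ⟨χ, hχ⟩ ⟨ψ, hψ⟩ h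
    have : χ ≠ ψ := fun h' => h (Subtype.ext h')
    exact horth this ⟨f χ, hf χ⟩ ⟨f ψ, hf ψ⟩
  · rw [← hsum, Finsupp.sum, ← Finset.sum_coe_sort]

lemma mpow_zero {n : ℕ} (z : Fin n → ℂ) : mpow z 0 = 1 := by simp [mpow]
lemma mpow_add {n : ℕ} (z : Fin n → ℂ) (α β : MIdx n) : mpow z (α + β) = mpow z α * mpow z β := by
  simp [mpow, pow_add, Finset.prod_mul_distrib]
lemma mpow_single {n : ℕ} (z : Fin n → ℂ) (i : Fin n) : mpow z (Pi.single i 1) = z i := by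
  rw [mpow, Finset.prod_eq_single i]
  · simp
  · intro j _ h; simp [Pi.single_eq_of_ne h]
  · simp
lemma mdeg_zero {n : ℕ} : mdeg (0 : MIdx n) = 0 := by simp [mdeg]
lemma mdeg_add {n : ℕ} (α β : MIdx n) : mdeg (α + β) = mdeg α + mdeg β := by
  simp [mdeg, Finset.sum_add_distrib]
lemma mdeg_single {n : ℕ} (i : Fin n) : mdeg (Pi.single i 1 : MIdx n) = 1 := by
  simp [mdeg]
lemma midx_cases {n : ℕ} (α : MIdx n) : α = 0 ∨ ∃ (β : MIdx n) (i : Fin n), α = β + Pi.single i 1 := by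
  by_cases h : α = 0
  · exact Or.inl h
  · right
    obtain ⟨i, hi⟩ := Function.ne_iff.1 h
    have hi : α i ≠ 0 := hi
    refine ⟨α - Pi.single i 1, i, ?_⟩
    funext j
    by_cases hj : j = i
    · subst hj; simp; omega
    · simp [hj]

lemma core_rep {n d : ℕ} (T : Fin n → W →ₗ[ℂ] W)
    (hN : ∀ i j, LinearMap.adjoint (T j) * T i = T i * LinearMap.adjoint (T j))
    (hC : ∀ i j, T i * T j = T j * T i) (u : MIdx n → W)
    (hT : ∀ i α, mdeg α + 1 ≤ d → T i (u α) = u (α + Pi.single i 1))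
    (hspan : Submodule.span ℂ {v | ∃ α, mdeg α ≤ d ∧ v = u α} = ⊤) :
    ∃ (zs : Fin (Module.finrank ℂ W) → (Fin n → ℂ)) (lam : Fin (Module.finrank ℂ W) → ℝ),
      Function.Injective zs ∧ (∀ j, 0 < lam j) ∧ ∀ α β, mdeg α ≤ d → mdeg β ≤ d →
        inner ℂ (u α) (u β) = 
          ∑ j, (lam j : ℂ) * (starRingEnd ℂ) (mpow (zs j) α) * mpow (zs j) β := by
  obtain ⟨ι, _, z, w, hz, hw0, heig, hort, hu0⟩ := joint_diag T hN hC (u 0)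
  have hu : ∀ N, ∀ α, mdeg α = N → mdeg α ≤ d → u α = ∑ k, mpow (z k) α • w k := by
    intro N
    induction N with
    | zero =>
      intro α h _
      rcases midx_cases α with rfl | ⟨β, i, rfl⟩
      · simp [mpow_zero, hu0]
      · rw [mdeg_add, mdeg_single] at h; omega
    | succ N ih =>
      intro α h hd
      rcases midx_cases α with rfl | ⟨β, i, rfl⟩
      · rw [mdeg_zero] at h; omega
      · rw [mdeg_add, mdeg_single] at h hd
        rw [← hT i β hd, ih β (by omega) (by omega), map_sum]
        refine Finset.sum_congr rfl fun k _ => ?_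
        rw [map_smul, heig, smul_smul, mpow_add, mpow_single]
  have hli : LinearIndependent ℂ w := 
    linearIndependent_of_ne_zero_of_inner_eq_zero hw0 (fun k l h => hort k l h)
  have hsp : ⊤ ≤ Submodule.span ℂ (Set.range w) := by
    rw [← hspan, Submodule.span_le]
    rintro v ⟨α, hα, rfl⟩
    rw [hu _ α rfl hα]
    exact Submodule.sum_mem _ fun k _ => Submodule.smul_mem _ _ (Submodule.subset_span ⟨k, rfl⟩)
  have hcard := Module.finrank_eq_card_basis (Module.Basis.mk hli hsp)
  let e : Fin (Module.finrank ℂ W) ≃ ι := (finCongr hcard).trans (Fintype.equivFin ι).symm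
  refine ⟨fun j => z (e j), fun j => ‖w (e j)‖^2, hz.comp e.injective, ?_, ?_⟩
  · intro j; have := norm_pos_iff.2 (hw0 (e j)); positivity
  · intro α β hα hβ
    rw [e.sum_comp (fun k => (((‖w k‖^2 : ℝ)) : ℂ) * (starRingEnd ℂ) (mpow (z k) α) * mpow (z k) β),
      hu _ α rfl hα, hu _ β rfl hβ, sum_inner]
    refine Finset.sum_congr rfl fun k _ => ?_
    rw [inner_sum, Finset.sum_eq_single k]
    · rw [inner_smul_left, inner_smul_right, inner_self_eq_norm_sq_to_K]
      push_cast; simp only [Complex.coe_algebraMap]; ring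
    · intro l _ h
      rw [inner_smul_left, inner_smul_right, hort k l h.symm]; simp
    · simp
end joint

section atomic
open Matrix

/-- finset of multi-indices of degree at most k -/
def degFS (n k : ℕ) : Finset (MIdx n) := Finset.univ.image (fun a : Idx n k => a.1)

lemma mem_degFS {n k : ℕ} {α : MIdx n} : α ∈ degFS n k ↔ mdeg α ≤ k := by
  simp only [degFS, Finset.mem_image, Finset.mem_univ, true_and]
  constructor
  · rintro ⟨a, rfl⟩; exact a.2
  · intro h; exact ⟨⟨α, h⟩, rfl⟩

lemma finsum2 {n k : ℕ} (F : MIdx n → MIdx n → ℂ) (hF : ∀ α β, F α β ≠ 0 → mdeg α ≤ k ∧ mdeg β ≤ k) :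
    ∑ᶠ α, ∑ᶠ β, F α β = ∑ α ∈ degFS n k, ∑ β ∈ degFS n k, F α β := by
  have h1 : ∀ α, ∑ᶠ β, F α β = ∑ β ∈ degFS n k, F α β := by
    intro α
    apply finsum_eq_sum_of_support_subset
    intro β hβ
    exact mem_degFS.2 (hF α β hβ).2
  simp only [h1]
  apply finsum_eq_sum_of_support_subset
  intro α hα
  obtain ⟨β, _, hβ⟩ := Finset.exists_ne_zero_of_sum_ne_zero hα
  exact mem_degFS.2 (hF α β hβ).1

lemma peval_eq {n k : ℕ} {c : MIdx n → MIdx n → ℂ} (hc : IsPolyDeg k c) (z : Fin n → ℂ) :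
    ((peval c z : ℝ) : ℂ) = ∑ α ∈ degFS n k, ∑ β ∈ degFS n k,
      c α β * (starRingEnd ℂ) (mpow z α) * mpow z β := by
  rw [peval, finsum2 (k := k) (fun α β => c α β * (starRingEnd ℂ) (mpow z α) * mpow z β)]
  · rw [← Complex.conj_eq_iff_re, map_sum]
    simp only [map_sum]
    rw [Finset.sum_comm]
    refine Finset.sum_congr rfl fun β _ => Finset.sum_congr rfl fun α _ => ?_
    simp only [map_mul, hc.2, Complex.conj_conj]
    ring
  · intro α β h
    exact hc.1 α β (fun h0 => h (by rw [h0]; simp))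

lemma momEntry_rep {n k d r : ℕ} {c y : MIdx n → MIdx n → ℂ} (hc : IsPolyDeg k c)
    (zs : Fin r → (Fin n → ℂ)) (lam : Fin r → ℝ)
    (hy : ∀ α β : MIdx n, mdeg α ≤ d → mdeg β ≤ d →
      y α β = ∑ j, (lam j : ℂ) * (starRingEnd ℂ) (mpow (zs j) α) * mpow (zs j) β)
    (α β : MIdx n) (hα : mdeg α + k ≤ d) (hβ : mdeg β + k ≤ d) :
    momEntry c y α β = ∑ j, ((lam j * peval c (zs j) : ℝ) : ℂ) *
      (starRingEnd ℂ) (mpow (zs j) α) * mpow (zs j) β := by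
  rw [momEntry, finsum2 (k := k) (fun γ δ => c γ δ * y (α + γ) (β + δ))]
  · simp only [Complex.ofReal_mul, peval_eq hc, Finset.mul_sum, Finset.sum_mul]
    rw [Finset.sum_comm (s := Finset.univ)]
    refine Finset.sum_congr rfl fun γ hγ => ?_
    rw [Finset.sum_comm (s := Finset.univ)]
    refine Finset.sum_congr rfl fun δ hδ => ?_
    have h1 := mem_degFS.1 hγ
    have h2 := mem_degFS.1 hδ
    rw [hy _ _ (by rw [mdeg_add]; omega) (by rw [mdeg_add]; omega), Finset.mul_sum]
    refine Finset.sum_congr rfl fun j _ => ?_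
    rw [mpow_add, mpow_add, map_mul]
    ring
  · intro γ δ h
    exact hc.1 γ δ (fun h0 => h (by rw [h0]; simp))

/-- evaluation matrix -/
def vand {n r : ℕ} (e : ℕ) (zs : Fin r → (Fin n → ℂ)) : Matrix (Fin r) (Idx n e) ℂ :=
  Matrix.of fun j a => mpow (zs j) a.1

lemma vdv_apply {r : ℕ} {ι : Type*} (V : Matrix (Fin r) ι ℂ) (w : Fin r → ℂ) (a b : ι) :
    (Vᴴ * diagonal w * V) a b = ∑ j, w j * (starRingEnd ℂ) (V j a) * V j b := by
  rw [Matrix.mul_apply]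
  refine Finset.sum_congr rfl fun j _ => ?_
  rw [Matrix.mul_diagonal, Matrix.conjTranspose_apply, Complex.star_def]
  ring

lemma momMatrix_rep {n k d r e : ℕ} {c y : MIdx n → MIdx n → ℂ} (hc : IsPolyDeg k c)
    (zs : Fin r → (Fin n → ℂ)) (lam : Fin r → ℝ)
    (hy : ∀ α β : MIdx n, mdeg α ≤ d → mdeg β ≤ d →
      y α β = ∑ j, (lam j : ℂ) * (starRingEnd ℂ) (mpow (zs j) α) * mpow (zs j) β)
    (he : e + k ≤ d) :
    momMatrix n e c y = (vand e zs)ᴴ *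
      diagonal (fun j => ((lam j * peval c (zs j) : ℝ) : ℂ)) * vand e zs := by
  ext a b
  rw [vdv_apply]
  have := a.2
  have := b.2
  exact momEntry_rep hc zs lam hy a.1 b.1 (by omega) (by omega)

lemma momMatrixId_rep {n d r e : ℕ} {y : MIdx n → MIdx n → ℂ}
    (zs : Fin r → (Fin n → ℂ)) (lam : Fin r → ℝ)
    (hy : ∀ α β : MIdx n, mdeg α ≤ d → mdeg β ≤ d →
      y α β = ∑ j, (lam j : ℂ) * (starRingEnd ℂ) (mpow (zs j) α) * mpow (zs j) β)
    (he : e ≤ d) :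
    momMatrixId n e y = (vand e zs)ᴴ * diagonal (fun j => (lam j : ℂ)) * vand e zs := by
  ext a b
  rw [vdv_apply]
  exact hy a.1 b.1 (a.2.trans he) (b.2.trans he)

lemma right_inv {n d r e : ℕ} {y : MIdx n → MIdx n → ℂ}
    (zs : Fin r → (Fin n → ℂ)) (lam : Fin r → ℝ)
    (hy : ∀ α β : MIdx n, mdeg α ≤ d → mdeg β ≤ d →
      y α β = ∑ j, (lam j : ℂ) * (starRingEnd ℂ) (mpow (zs j) α) * mpow (zs j) β)
    (he : e ≤ d) (hr : (momMatrixId n e y).rank = r) :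
    ∃ B : Matrix (Idx n e) (Fin r) ℂ, vand e zs * B = 1 := by
  rw [← mulVec_surjective_iff_exists_right_inverse]
  have h1 : r ≤ (vand e zs).rank := by
    rw [momMatrixId_rep zs lam hy he] at hr
    have := rank_mul_le_right ((vand e zs)ᴴ * diagonal (fun j => (lam j : ℂ))) (vand e zs)
    omega
  have h2 : LinearMap.range (vand e zs).mulVecLin = ⊤ := by
    apply Submodule.eq_top_of_finrank_eq
    apply le_antisymm (Submodule.finrank_le _)
    simpa [Matrix.rank] using h1
  exact LinearMap.range_eq_top.1 h2

lemma diag_of_right_inv {r : ℕ} {ι : Type*} [Fintype ι] (V : Matrix (Fin r) ι ℂ) (B : Matrix ι (Fin r) ℂ)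
    (h : V * B = 1) (w : Fin r → ℂ) : Bᴴ * (Vᴴ * diagonal w * V) * B = diagonal w := by
  have h' : Bᴴ * Vᴴ = 1 := by rw [← conjTranspose_mul, h, conjTranspose_one]
  calc Bᴴ * (Vᴴ * diagonal w * V) * B = (Bᴴ * Vᴴ) * diagonal w * (V * B) := by
        simp only [Matrix.mul_assoc]
    _ = _ := by rw [h, h']; simp

lemma incl_sub {n e e' : ℕ} (h : e ≤ e') (c y : MIdx n → MIdx n → ℂ) :
    momMatrix n e c y = (momMatrix n e' c y).submatrix (fun a => ⟨a.1, a.2.trans h⟩)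
      (fun a => ⟨a.1, a.2.trans h⟩) := rfl

lemma inclId_sub {n e e' : ℕ} (h : e ≤ e') (y : MIdx n → MIdx n → ℂ) :
    momMatrixId n e y = (momMatrixId n e' y).submatrix (fun a => ⟨a.1, a.2.trans h⟩)
      (fun a => ⟨a.1, a.2.trans h⟩) := rfl

lemma rank_top_rep {n d r e : ℕ} {y : MIdx n → MIdx n → ℂ}
    (zs : Fin r → (Fin n → ℂ)) (lam : Fin r → ℝ)
    (hy : ∀ α β : MIdx n, mdeg α ≤ d → mdeg β ≤ d →
      y α β = ∑ j, (lam j : ℂ) * (starRingEnd ℂ) (mpow (zs j) α) * mpow (zs j) β)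
    (he : e ≤ d) (hr : (momMatrixId n e y).rank = r) : (momMatrixId n d y).rank = r := by
  apply le_antisymm
  · rw [momMatrixId_rep zs lam hy le_rfl]
    refine (rank_mul_le_right _ _).trans ?_
    exact (rank_le_card_height _).trans (by rw [Fintype.card_fin])
  · rw [← hr, inclId_sub he y]
    exact rank_submatrix_le _ _ _

lemma zero_count {n k d r e : ℕ} {c y : MIdx n → MIdx n → ℂ} (hc : IsPolyDeg k c)
    (zs : Fin r → (Fin n → ℂ)) (lam : Fin r → ℝ) (hl : ∀ j, 0 < lam j)
    (hy : ∀ α β : MIdx n, mdeg α ≤ d → mdeg β ≤ d →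
      y α β = ∑ j, (lam j : ℂ) * (starRingEnd ℂ) (mpow (zs j) α) * mpow (zs j) β)
    (he : e + k ≤ d) (hr : (momMatrixId n e y).rank = r) :
    {j | peval c (zs j) = 0}.ncard = (momMatrixId n d y).rank - (momMatrix n e c y).rank := by
  rw [rank_top_rep zs lam hy (by omega) hr]
  obtain ⟨B, hB⟩ := right_inv zs lam hy (by omega) hr
  have hrank : (momMatrix n e c y).rank =
      (diagonal (fun j => ((lam j * peval c (zs j) : ℝ) : ℂ))).rank := by
    rw [momMatrix_rep hc zs lam hy he]
    apply le_antisymm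
    · exact (rank_mul_le_left _ _).trans (rank_mul_le_right _ _)
    · conv_lhs => rw [← diag_of_right_inv _ B hB]
      exact (rank_mul_le_left _ _).trans (rank_mul_le_right _ _)
  rw [hrank, rank_diagonal]
  have : ∀ j, ((lam j * peval c (zs j) : ℝ) : ℂ) ≠ 0 ↔ ¬ (peval c (zs j) = 0) := by
    intro j
    rw [Ne, Complex.ofReal_eq_zero, mul_eq_zero]
    simp [(hl j).ne']
  rw [Fintype.card_subtype]
  simp only [this]
  rw [Set.ncard_eq_toFinset_card']
  have h2 := Finset.card_filter_add_card_filter_not (s := (Finset.univ : Finset (Fin r))) (fun j => peval c (zs j) = 0)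
  simp only [Finset.card_univ, Fintype.card_fin] at h2
  have h3 : ({j | peval c (zs j) = 0} : Set (Fin r)).toFinset = Finset.univ.filter (fun j => peval c (zs j) = 0) := by
    ext j; simp
  rw [h3]
  omega

lemma psd_of_rep {r : ℕ} {ι : Type*} [Fintype ι] (V : Matrix (Fin r) ι ℂ) (w : Fin r → ℝ) (hw : ∀ j, 0 ≤ w j) :
    (Vᴴ * diagonal (fun j => (w j : ℂ)) * V).PosSemidef := by
  apply PosSemidef.conjTranspose_mul_mul_same
  apply PosSemidef.diagonal
  intro j
  simpa using hw j

lemma loc_psd {n d r e : ℕ} {y : MIdx n → MIdx n → ℂ}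
    (zs : Fin r → (Fin n → ℂ)) (lam : Fin r → ℝ) (hl : ∀ j, 0 < lam j)
    (hy : ∀ α β : MIdx n, mdeg α ≤ d → mdeg β ≤ d →
      y α β = ∑ j, (lam j : ℂ) * (starRingEnd ℂ) (mpow (zs j) α) * mpow (zs j) β)
    (he : e + 1 ≤ d) (i j : Fin n) : (locMat3 n e y i j).PosSemidef := by
  have : locMat3 n e y i j = (Matrix.of fun k (a : Fin 3 × Idx n e) => mpow (zs k) a.2.1 *
      (starRingEnd ℂ) (mpow (zs k) (![0, Pi.single i 1, Pi.single j 1] a.1)) : Matrix (Fin r) _ ℂ)ᴴ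
      * diagonal (fun j => (lam j : ℂ)) * (Matrix.of fun k (a : Fin 3 × Idx n e) => mpow (zs k) a.2.1 *
      (starRingEnd ℂ) (mpow (zs k) (![0, Pi.single i 1, Pi.single j 1] a.1)) : Matrix (Fin r) _ ℂ) := by
    ext a b
    rw [vdv_apply]
    have hs : ∀ p : Fin 3, mdeg ((![0, Pi.single i 1, Pi.single j 1] : Fin 3 → MIdx n) p) ≤ 1 := by
      intro p
      fin_cases p <;> simp [mdeg_zero, mdeg_single]
    have h1 := hs a.1
    have h2 := hs b.1
    have h3 := a.2.2
    have h4 := b.2.2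
    simp only [locMat3, Matrix.of_apply]
    rw [hy _ _ (by rw [mdeg_add]; omega) (by rw [mdeg_add]; omega)]
    refine Finset.sum_congr rfl fun j _ => ?_
    rw [mpow_add, mpow_add]
    simp only [map_mul, Complex.conj_conj]
    ring
  rw [this]
  exact psd_of_rep _ _ fun j => (hl j).le

lemma peval_nonneg_of_psd {n k d r e : ℕ} {c y : MIdx n → MIdx n → ℂ} (hc : IsPolyDeg k c)
    (zs : Fin r → (Fin n → ℂ)) (lam : Fin r → ℝ) (hl : ∀ j, 0 < lam j)
    (hy : ∀ α β : MIdx n, mdeg α ≤ d → mdeg β ≤ d →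
      y α β = ∑ j, (lam j : ℂ) * (starRingEnd ℂ) (mpow (zs j) α) * mpow (zs j) β)
    (he : e + k ≤ d) (hr : (momMatrixId n e y).rank = r) 
    (hpsd : (momMatrix n (d - k) c y).PosSemidef) (j : Fin r) : 0 ≤ peval c (zs j) := by
  obtain ⟨B, hB⟩ := right_inv zs lam hy (by omega) hr
  have h1 : (momMatrix n e c y).PosSemidef := by
    rw [incl_sub (show e ≤ d - k by omega)]
    exact hpsd.submatrix _
  rw [momMatrix_rep hc zs lam hy he] at h1
  have h2 := h1.conjTranspose_mul_mul_same B
  rw [diag_of_right_inv _ B hB, posSemidef_diagonal_iff] at h2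
  have := h2 j
  rw [← Complex.ofReal_zero, Complex.real_le_real] at this
  exact nonneg_of_mul_nonneg_right this (hl j)
end atomic

section back
open Matrix

open scoped MatrixOrder in
lemma psd_factor {ι : Type*} [Fintype ι] (M : Matrix ι ι ℂ) (h : M.PosSemidef) :
    ∃ B : Matrix ι ι ℂ, M = Bᴴ * B := by
  obtain ⟨B, hB⟩ := CStarAlgebra.nonneg_iff_eq_star_mul_self.mp h.nonneg
  exact ⟨B, hB⟩

lemma finrank_gram {ι κ : Type*} [Fintype ι] [Fintype κ] (B : Matrix ι κ ℂ) :
    Module.finrank ℂ (Submodule.span ℂ (Set.range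
      (fun b : κ => (WithLp.toLp 2 (fun k => B k b) : EuclideanSpace ℂ ι)))) = (Bᴴ * B).rank := by
  rw [rank_conjTranspose_mul_self, rank_eq_finrank_span_cols]
  rw [← LinearEquiv.finrank_map_eq (WithLp.linearEquiv 2 ℂ (ι → ℂ)), Submodule.map_span, ← Set.range_comp]
  rfl

lemma gns {n d e : ℕ} (he : e ≤ d) (y : MIdx n → MIdx n → ℂ)
    (hpsd : (momMatrixId n d y).PosSemidef)
    (hrank : (momMatrixId n d y).rank = (momMatrixId n e y).rank) :
    ∃ (W : Submodule ℂ (EuclideanSpace ℂ (Idx n d))) (u : MIdx n → W),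
      Module.finrank ℂ W = (momMatrixId n e y).rank ∧
      (∀ α β, mdeg α ≤ d → mdeg β ≤ d → inner ℂ (u α) (u β) = y α β) ∧
      Submodule.span ℂ (Set.range (fun a : Idx n e => u a.1)) = ⊤ := by
  obtain ⟨B, hB⟩ := psd_factor _ hpsd
  let v : Idx n d → EuclideanSpace ℂ (Idx n d) := fun b => WithLp.toLp 2 (fun k => B k b)
  let inc : Idx n e → Idx n d := fun a => ⟨a.1, a.2.trans he⟩
  have hBe : momMatrixId n e y = (B.submatrix id inc)ᴴ * (B.submatrix id inc) := by
    rw [inclId_sub he, hB]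
    rfl
  let W := Submodule.span ℂ (Set.range (fun a => v (inc a)))
  let W' := Submodule.span ℂ (Set.range v)
  have hW : Module.finrank ℂ W = (momMatrixId n e y).rank := by
    rw [hBe]; exact finrank_gram (B.submatrix id inc)
  have hW' : Module.finrank ℂ W' = (momMatrixId n d y).rank := by
    rw [hB]; exact finrank_gram B
  have hle : W ≤ W' := Submodule.span_mono (by rintro _ ⟨a, rfl⟩; exact ⟨inc a, rfl⟩)
  have heq : W = W' := Submodule.eq_of_le_of_finrank_eq hle (by rw [hW, hW', hrank])
  have hmem : ∀ b, v b ∈ W := fun b => by rw [heq]; exact Submodule.subset_span ⟨b, rfl⟩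
  let u : MIdx n → W := fun α => if h : mdeg α ≤ d then ⟨v (⟨α, h⟩ : Idx n d), hmem _⟩ else 0
  have hudef : ∀ α (h : mdeg α ≤ d), u α = ⟨v (⟨α, h⟩ : Idx n d), hmem _⟩ := fun α h => dif_pos h
  refine ⟨W, u, hW, ?_, ?_⟩
  · intro α β hα hβ
    rw [hudef α hα, hudef β hβ, Submodule.coe_inner]
    have hBab : ∀ a b : Idx n d, y a.1 b.1 = ∑ k, star (B k a) * B k b := by
      intro a b
      have := congrFun (congrFun hB a) b
      rw [Matrix.mul_apply] at this
      exact this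
    rw [show y α β = _ from hBab ⟨α, hα⟩ ⟨β, hβ⟩, PiLp.inner_apply]
    refine Finset.sum_congr rfl fun k _ => ?_
    simp [v, mul_comm]
  · apply Submodule.map_injective_of_injective W.injective_subtype
    rw [Submodule.map_span, ← Set.range_comp, Submodule.map_top, Submodule.range_subtype]
    show _ = Submodule.span ℂ (Set.range (fun a => v (inc a)))
    congr 2
    funext a
    simp only [Function.comp]
    rw [hudef _ (a.2.trans he)]
    rfl

lemma momEntry_ball {n : ℕ} (c y : MIdx n → MIdx n → ℂ) (a : ℂ) (J : Finset (Fin n))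
    (hc : ∀ γ δ, c γ δ = (if γ = 0 ∧ δ = 0 then a else 0) +
      ∑ j ∈ J, if γ = Pi.single j 1 ∧ δ = Pi.single j 1 then -1 else 0) (α β : MIdx n) :
    momEntry c y α β = a * y α β - ∑ j ∈ J, y (α + Pi.single j 1) (β + Pi.single j 1) := by
  rw [momEntry, finsum2 (k := 1) (fun γ δ => c γ δ * y (α + γ) (β + δ))]
  · have h0 : (0 : MIdx n) ∈ degFS n 1 := mem_degFS.2 (by rw [mdeg_zero]; omega)
    have h1 : ∀ j : Fin n, (Pi.single j 1 : MIdx n) ∈ degFS n 1 := fun j =>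
      mem_degFS.2 (by rw [mdeg_single])
    have key : ∀ (x : MIdx n) (b : ℂ), x ∈ degFS n 1 → ∑ γ ∈ degFS n 1, ∑ δ ∈ degFS n 1,
        (if γ = x ∧ δ = x then b else 0) * y (α + γ) (β + δ) = b * y (α + x) (β + x) := by
      intro x b hx
      rw [Finset.sum_eq_single x, Finset.sum_eq_single x]
      · simp
      · intro δ _ h; simp [h]
      · intro h; exact absurd hx h
      · intro γ _ h; simp [h]
      · intro h; exact absurd hx h
    simp only [hc, add_mul, Finset.sum_add_distrib, Finset.sum_mul]
    rw [key 0 a h0]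
    have : ∀ γ ∈ degFS n 1, ∑ δ ∈ degFS n 1, ∑ j ∈ J,
        (if γ = Pi.single j 1 ∧ δ = Pi.single j 1 then (-1:ℂ) else 0) * y (α + γ) (β + δ) =
        ∑ j ∈ J, ∑ δ ∈ degFS n 1,
        (if γ = Pi.single j 1 ∧ δ = Pi.single j 1 then (-1:ℂ) else 0) * y (α + γ) (β + δ) :=
      fun γ _ => Finset.sum_comm
    rw [Finset.sum_congr rfl this, Finset.sum_comm, Finset.sum_congr rfl (fun j _ => key _ _ (h1 j))]
    simp [sub_eq_add_neg]
  · intro γ δ h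
    have h' : c γ δ ≠ 0 := fun h0 => h (by rw [h0]; simp)
    rw [hc] at h'
    by_cases h0 : γ = 0 ∧ δ = 0
    · rw [h0.1, h0.2, mdeg_zero]; omega
    · rw [if_neg h0, zero_add] at h'
      obtain ⟨j, _, hj⟩ := Finset.exists_ne_zero_of_sum_ne_zero h'
      have := (ite_ne_right_iff.1 hj).1
      rw [this.1, this.2, mdeg_single]; omega

lemma single_ne_zero' {n : ℕ} (j : Fin n) : (Pi.single j 1 : MIdx n) ≠ 0 := by
  intro h
  have := congrFun h j
  simp at this

lemma coord_ball {n : ℕ} (j : Fin n) (R : ℝ) (γ δ : MIdx n) :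
    coordPoly n j R γ δ = (if γ = 0 ∧ δ = 0 then ((R^2 : ℝ) : ℂ) else 0) +
      ∑ j ∈ {j}, if γ = Pi.single j 1 ∧ δ = Pi.single j 1 then -1 else 0 := by
  rw [Finset.sum_singleton, coordPoly]
  by_cases h : γ = 0 ∧ δ = 0
  · rw [if_pos h, if_pos h, if_neg, add_zero]
    rintro ⟨h1, _⟩
    exact single_ne_zero' j (h1.symm.trans h.1)
  · rw [if_neg h, if_neg h, zero_add]

lemma sphere_ball {n : ℕ} (R : ℝ) (γ δ : MIdx n) :
    spherePoly n R γ δ = (if γ = 0 ∧ δ = 0 then ((R^2 : ℝ) : ℂ) else 0) +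
      ∑ j ∈ Finset.univ, if γ = Pi.single j 1 ∧ δ = Pi.single j 1 then -1 else 0 := by
  rw [spherePoly]
  by_cases h : γ = 0 ∧ δ = 0
  · rw [if_pos h, if_pos h, Finset.sum_eq_zero, add_zero]
    intro j _
    rw [if_neg]
    rintro ⟨h1, _⟩
    exact single_ne_zero' j (h1.symm.trans h.1)
  · rw [if_neg h, if_neg h, zero_add]
    by_cases h2 : ∃ i : Fin n, γ = Pi.single i 1 ∧ δ = Pi.single i 1
    · rw [if_pos h2]
      obtain ⟨i, h3, h4⟩ := h2
      rw [Finset.sum_eq_single i]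
      · rw [if_pos ⟨h3, h4⟩]
      · intro j _ hj
        rw [if_neg]
        rintro ⟨h5, _⟩
        have := congrFun (h5.symm.trans h3) j
        simp [hj] at this
      · simp
    · rw [if_neg h2, Finset.sum_eq_zero]
      intro j _
      rw [if_neg]
      exact fun h3 => h2 ⟨j, h3⟩

variable {W : Type*} [NormedAddCommGroup W] [InnerProductSpace ℂ W] [FiniteDimensional ℂ W]

lemma inner_comb {ι : Type*} [Fintype ι] (c c' : ι → ℂ) (f f' : ι → W) :
    inner ℂ (∑ a, c a • f a) (∑ b, c' b • f' b) =
      ∑ a, ∑ b, (starRingEnd ℂ) (c a) * (inner ℂ (f a) (f' b) * c' b) := by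
  rw [sum_inner]
  refine Finset.sum_congr rfl fun a _ => ?_
  rw [inner_sum]
  refine Finset.sum_congr rfl fun b _ => ?_
  rw [inner_smul_left, inner_smul_right]
  ring

lemma quad_expand {ι : Type*} [Fintype ι] (M : Matrix ι ι ℂ) (c : ι → ℂ) :
    star c ⬝ᵥ (M *ᵥ c) = ∑ a, ∑ b, (starRingEnd ℂ) (c a) * (M a b * c b) := by
  simp only [dotProduct, mulVec, Finset.mul_sum, Pi.star_apply, Complex.star_def]

lemma ker_shift {n d : ℕ} (y : MIdx n → MIdx n → ℂ) (u : MIdx n → W)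
    (hu : ∀ α β, mdeg α ≤ d → mdeg β ≤ d → inner ℂ (u α) (u β) = y α β)
    (hd : 1 ≤ d) (c : MIdx n → MIdx n → ℂ) (a : ℂ) (J : Finset (Fin n))
    (hc : ∀ γ δ, c γ δ = (if γ = 0 ∧ δ = 0 then a else 0) +
      ∑ j ∈ J, if γ = Pi.single j 1 ∧ δ = Pi.single j 1 then -1 else 0)
    (hpsd : (momMatrix n (d - 1) c y).PosSemidef) (i : Fin n) (hi : i ∈ J)
    (p : Idx n (d-1) → ℂ) (hp : ∑ b, p b • u b.1 = 0) :
    ∑ b, p b • u (b.1 + Pi.single i 1) = 0 := by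
  have h1 := hpsd.dotProduct_mulVec_nonneg p
  rw [quad_expand] at h1
  have h2 : ∑ b, ∑ b', (starRingEnd ℂ) (p b) * (momMatrix n (d-1) c y b b' * p b') =
      a * inner ℂ (∑ b, p b • u b.1) (∑ b, p b • u b.1) -
      ∑ j ∈ J, inner ℂ (∑ b, p b • u (b.1 + Pi.single j 1)) (∑ b, p b • u (b.1 + Pi.single j 1)) := by
    simp only [inner_comb]
    rw [Finset.mul_sum, Finset.sum_comm (s := J), ← Finset.sum_sub_distrib]
    refine Finset.sum_congr rfl fun b _ => ?_
    rw [Finset.mul_sum, Finset.sum_comm (s := J), ← Finset.sum_sub_distrib]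
    refine Finset.sum_congr rfl fun b' _ => ?_
    have e1 : momMatrix n (d-1) c y b b' = momEntry c y b.1 b'.1 := rfl
    have hb := b.2
    have hb' := b'.2
    rw [e1, momEntry_ball c y a J hc, hu _ _ (by omega) (by omega), sub_mul, mul_sub, Finset.sum_mul,
      Finset.mul_sum]
    congr 1
    · ring
    · refine Finset.sum_congr rfl fun j _ => ?_
      rw [hu _ _ (by rw [mdeg_add, mdeg_single]; omega) (by rw [mdeg_add, mdeg_single]; omega)]
  rw [h2, hp, inner_zero_left, mul_zero, zero_sub] at h1
  have h3 := (Complex.le_def.1 h1).1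
  have e4 : ∀ w : W, (inner ℂ w w : ℂ).re = ‖w‖^2 := fun w => inner_self_eq_norm_sq (𝕜 := ℂ) w
  simp only [Complex.zero_re, Complex.neg_re, Complex.re_sum, e4] at h3
  have h4 := Finset.single_le_sum (f := fun j => ‖∑ b, p b • u (b.1 + Pi.single j 1)‖^2)
    (fun j _ => sq_nonneg _) hi
  have h5 : ‖∑ b, p b • u (b.1 + Pi.single i 1)‖^2 ≤ 0 := by
    linarith
  have h6 : ‖∑ b, p b • u (b.1 + Pi.single i 1)‖ = 0 := by
    apply pow_eq_zero_iff (two_ne_zero) |>.1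
    exact le_antisymm h5 (sq_nonneg _)
  exact norm_eq_zero.1 h6

lemma exists_shift {n f : ℕ} (u : MIdx n → W)
    (hspan : Submodule.span ℂ (Set.range (fun a : Idx n f => u a.1)) = ⊤) (i : Fin n)
    (hker : ∀ p : Idx n f → ℂ, ∑ b, p b • u b.1 = 0 → ∑ b, p b • u (b.1 + Pi.single i 1) = 0) :
    ∃ T : W →ₗ[ℂ] W, ∀ α, mdeg α ≤ f → T (u α) = u (α + Pi.single i 1) := by
  let P : (Idx n f → ℂ) →ₗ[ℂ] W := Fintype.linearCombination ℂ (fun a : Idx n f => u a.1)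
  let S : (Idx n f → ℂ) →ₗ[ℂ] W :=
    Fintype.linearCombination ℂ (fun a : Idx n f => u (a.1 + Pi.single i 1))
  have hP : LinearMap.range P = ⊤ := by
    rw [← hspan]; exact Fintype.range_linearCombination ℂ _
  obtain ⟨Q, hQ⟩ := P.exists_rightInverse_of_surjective hP
  refine ⟨S ∘ₗ Q, fun α hα => ?_⟩
  let al : Idx n f := ⟨α, hα⟩
  have h1 : u α = P (Pi.single al 1) := by
    rw [Fintype.linearCombination_apply_single, one_smul]
  have h2 : u (α + Pi.single i 1) = S (Pi.single al 1) := by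
    rw [Fintype.linearCombination_apply_single, one_smul]
  rw [h2, LinearMap.comp_apply, ← sub_eq_zero, ← map_sub]
  apply hker
  show P _ = 0
  rw [map_sub, ← h1, sub_eq_zero]
  exact LinearMap.congr_fun hQ (u α)

lemma loc_block {n d e : ℕ} (y : MIdx n → MIdx n → ℂ) (u : MIdx n → W)
    (hu : ∀ α β, mdeg α ≤ d → mdeg β ≤ d → inner ℂ (u α) (u β) = y α β)
    (he : e + 1 ≤ d)
    (hspan : Submodule.span ℂ (Set.range (fun a : Idx n e => u a.1)) = ⊤)
    (T : Fin n → W →ₗ[ℂ] W) (hT : ∀ i α, mdeg α + 1 ≤ d → T i (u α) = u (α + Pi.single i 1))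
    (i j : Fin n) (hpsd : (locMat3 n e y i j).PosSemidef) (x0 x1 x2 : W) :
    0 ≤ (inner ℂ x0 x0 + inner ℂ (T i x0) x1 + inner ℂ (T j x0) x2
      + inner ℂ x1 (T i x0) + inner ℂ x2 (T j x0)
      + inner ℂ (T i x1) (T i x1) + inner ℂ (T j x1) (T i x2) + inner ℂ (T i x2) (T j x1)
      + inner ℂ (T j x2) (T j x2)).re := by
  have hex : ∀ x : W, ∃ c : Idx n e → ℂ, x = ∑ a, c a • u a.1 := by
    intro x
    have : x ∈ LinearMap.range (Fintype.linearCombination ℂ (fun a : Idx n e => u a.1)) := by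
      rw [Fintype.range_linearCombination, hspan]; trivial
    obtain ⟨c, hc⟩ := this
    exact ⟨c, hc.symm⟩
  let x : Fin 3 → W := ![x0, x1, x2]
  choose c hc using fun p => hex (x p)
  let s : Fin 3 → MIdx n := ![0, Pi.single i 1, Pi.single j 1]
  let t : Fin 3 → (W →ₗ[ℂ] W) := ![LinearMap.id, T i, T j]
  have ht : ∀ q α, mdeg α ≤ e → t q (u α) = u (α + s q) := by
    intro q α hα
    fin_cases q
    · simp [t, s]
    · exact hT i α (by omega)
    · exact hT j α (by omega)
  have hs : ∀ p : Fin 3, mdeg (s p) ≤ 1 := by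
    intro p
    fin_cases p <;> simp [s, mdeg_zero, mdeg_single]
  have htx : ∀ q p, t q (x p) = ∑ a, c p a • u (a.1 + s q) := by
    intro q p
    rw [hc p, map_sum]
    refine Finset.sum_congr rfl fun a _ => ?_
    rw [map_smul, ht q a.1 a.2]
  have h1 := hpsd.dotProduct_mulVec_nonneg (fun a => c a.1 a.2)
  rw [quad_expand] at h1
  have h2 : ∑ a : Fin 3 × Idx n e, ∑ b : Fin 3 × Idx n e,
      (starRingEnd ℂ) (c a.1 a.2) * (locMat3 n e y i j a b * c b.1 b.2) =
      ∑ p, ∑ q, inner ℂ (t q (x p)) (t p (x q)) := by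
    rw [Fintype.sum_prod_type]
    refine Finset.sum_congr rfl fun p _ => ?_
    simp only [htx, inner_comb]
    rw [Finset.sum_comm (s := (Finset.univ : Finset (Fin 3)))]
    refine Finset.sum_congr rfl fun a _ => ?_
    rw [Fintype.sum_prod_type]
    refine Finset.sum_congr rfl fun q _ => ?_
    refine Finset.sum_congr rfl fun b _ => ?_
    have := hs p
    have := hs q
    have ha := a.2
    have hb := b.2
    rw [hu _ _ (by rw [mdeg_add]; omega) (by rw [mdeg_add]; omega)]
    rfl
  rw [h2] at h1
  have h3 := (Complex.le_def.1 h1).1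
  simp only [Fin.sum_univ_three] at h3
  simp only [t, x, Matrix.cons_val_zero, Matrix.cons_val_one, Matrix.cons_val, LinearMap.id_apply, Complex.zero_re, Complex.add_re] at h3
  simp only [Complex.add_re]
  linarith
end back

lemma ball_deg {n k : ℕ} {c : MIdx n → MIdx n → ℂ} (hc : IsPolyDeg k c) (ht : HasTopDeg k c)
    {a : ℂ} {J : Finset (Fin n)} {i : Fin n} (hi : i ∈ J)
    (hJ : ∀ γ δ, c γ δ = (if γ = 0 ∧ δ = 0 then a else 0) +
        ∑ j ∈ J, if γ = Pi.single j 1 ∧ δ = Pi.single j 1 then -1 else 0) : k = 1 := by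
  apply le_antisymm
  · obtain ⟨α, β, h1, _, h3⟩ := ht
    rw [hJ] at h3
    by_cases h0 : α = 0 ∧ β = 0
    · rw [h0.1, mdeg_zero] at h1; omega
    · rw [if_neg h0, zero_add] at h3
      obtain ⟨j, _, hj⟩ := Finset.exists_ne_zero_of_sum_ne_zero h3
      have := (ite_ne_right_iff.1 hj).1
      rw [this.1, mdeg_single] at h1; omega
  · have : c (Pi.single i 1) (Pi.single i 1) ≠ 0 := by
      rw [hJ, if_neg (fun h => single_ne_zero' i h.1), zero_add, Finset.sum_eq_single i]
      · simp
      · intro j _ hj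
        rw [if_neg]
        rintro ⟨h5, _⟩
        have := congrFun h5 j
        simp [hj] at this
      · intro h; exact absurd hi h
    have := (hc.1 _ _ this).1
    rwa [mdeg_single] at this

lemma back_core {W : Type*} [NormedAddCommGroup W] [InnerProductSpace ℂ W] [FiniteDimensional ℂ W]
    {n d e : ℕ} (hn : 1 < n) (y : MIdx n → MIdx n → ℂ) (u : MIdx n → W)
    (hu : ∀ α β, mdeg α ≤ d → mdeg β ≤ d → inner ℂ (u α) (u β) = y α β)
    (he1 : e + 1 ≤ d)
    (hspan : Submodule.span ℂ (Set.range (fun a : Idx n e => u a.1)) = ⊤)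
    (T : Fin n → W →ₗ[ℂ] W) (hT : ∀ i α, mdeg α + 1 ≤ d → T i (u α) = u (α + Pi.single i 1))
    (hloc : ∀ i j : Fin n, i < j → (locMat3 n e y i j).PosSemidef) :
    (∀ i j, LinearMap.adjoint (T j) * T i = T i * LinearMap.adjoint (T j)) ∧
    (∀ i j, T i * T j = T j * T i) := by
  have hblk : ∀ i j : Fin n, i < j →
      LinearMap.adjoint (T i) * T i = T i * LinearMap.adjoint (T i) ∧
      LinearMap.adjoint (T j) * T j = T j * LinearMap.adjoint (T j) ∧
      LinearMap.adjoint (T j) * T i = T i * LinearMap.adjoint (T j) := fun i j hij =>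
    block_cond (T i) (T j) (loc_block y u hu he1 hspan T hT i j (hloc i j hij))
  have hnorm : ∀ i, LinearMap.adjoint (T i) * T i = T i * LinearMap.adjoint (T i) := by
    intro i
    by_cases hi : i = ⟨0, by omega⟩
    · exact (hblk i ⟨1, hn⟩ (by rw [hi]; simp [Fin.lt_def])).1
    · have : (⟨0, by omega⟩ : Fin n) < i := by
        rw [Fin.lt_def]
        have : i.1 ≠ 0 := fun h => hi (Fin.ext h)
        simp only; omega
      exact (hblk _ i this).2.1
  have hN : ∀ i j, LinearMap.adjoint (T j) * T i = T i * LinearMap.adjoint (T j) := by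
    intro i j
    rcases lt_trichotomy i j with h | h | h
    · exact (hblk i j h).2.2
    · rw [h]; exact hnorm j
    · have := congrArg LinearMap.adjoint (hblk j i h).2.2
      simpa [Module.End.mul_eq_comp, LinearMap.adjoint_comp] using this
  have hC : ∀ i j, T i * T j = T j * T i := fun i j =>
    fug (T i) (T j) (hnorm j) (hN i j).symm
  exact ⟨hN, hC⟩

lemma back_all {W : Type*} [NormedAddCommGroup W] [InnerProductSpace ℂ W] [FiniteDimensional ℂ W]
    {n m d e : ℕ} (hn : 1 < n) (g : Fin m → MIdx n → MIdx n → ℂ) (kk : Fin m → ℕ)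
    (i0 : Fin n → Fin m) (a : Fin n → ℂ) (J : Fin n → Finset (Fin n)) (hJ : ∀ i, i ∈ J i)
    (hgJ : ∀ i γ δ, g (i0 i) γ δ = (if γ = 0 ∧ δ = 0 then a i else 0) +
        ∑ j ∈ J i, if γ = Pi.single j 1 ∧ δ = Pi.single j 1 then -1 else 0)
    (hkk : ∀ i, kk (i0 i) = 1)
    (y : MIdx n → MIdx n → ℂ) (u : MIdx n → W)
    (hu : ∀ α β, mdeg α ≤ d → mdeg β ≤ d → inner ℂ (u α) (u β) = y α β)
    (he1 : e + 1 ≤ d)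
    (hspan : Submodule.span ℂ (Set.range (fun a : Idx n e => u a.1)) = ⊤)
    (hpsdg : ∀ i, (momMatrix n (d - kk i) (g i) y).PosSemidef)
    (hloc : ∀ i j : Fin n, i < j → (locMat3 n e y i j).PosSemidef) :
    ∃ (zs : Fin (Module.finrank ℂ W) → (Fin n → ℂ)) (lam : Fin (Module.finrank ℂ W) → ℝ),
      Function.Injective zs ∧ (∀ j, 0 < lam j) ∧ ∀ α β, mdeg α ≤ d → mdeg β ≤ d →
        inner ℂ (u α) (u β) = 
          ∑ j, (lam j : ℂ) * (starRingEnd ℂ) (mpow (zs j) α) * mpow (zs j) β := by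
  have hspan1 : Submodule.span ℂ (Set.range (fun a : Idx n (d-1) => u a.1)) = ⊤ := by
    rw [eq_top_iff, ← hspan]
    apply Submodule.span_mono
    rintro _ ⟨b, rfl⟩
    exact ⟨⟨b.1, b.2.trans (by omega)⟩, rfl⟩
  have hspand : Submodule.span ℂ {v | ∃ α, mdeg α ≤ d ∧ v = u α} = ⊤ := by
    rw [eq_top_iff, ← hspan]
    apply Submodule.span_mono
    rintro _ ⟨b, rfl⟩
    exact ⟨b.1, b.2.trans (by omega), rfl⟩
  have hex : ∀ i, ∃ T : W →ₗ[ℂ] W, ∀ α, mdeg α ≤ d - 1 → T (u α) = u (α + Pi.single i 1) := by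
    intro i
    apply exists_shift u hspan1 i
    apply ker_shift y u hu (by omega) (g (i0 i)) (a i) (J i) (hgJ i) _ i (hJ i)
    have := hpsdg (i0 i)
    rwa [hkk i] at this
  choose T hT' using hex
  have hT : ∀ i α, mdeg α + 1 ≤ d → T i (u α) = u (α + Pi.single i 1) :=
    fun i α h => hT' i α (by omega)
  obtain ⟨hN, hC⟩ := back_core hn y u hu he1 hspan T hT hloc
  exact core_rep (d := d) T hN hC u hT hspand

/-- Solution of the truncated complex moment problem: `y ∈ H_d` is represented by a
positive `rank M_{d−d_K}(y)`-atomic measure supported on `K` if and only if the three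
positivity/rank/commutativity conditions hold; and in that case, for each `i` the
measure has exactly `rank M_d(y) − rank M_{d−d_K}(g_i y)` atoms that are zeros of `g_i`. -/
theorem stmt11 (n m : ℕ) (hn : 1 < n)
    (g : Fin m → MIdx n → MIdx n → ℂ) (kk : Fin m → ℕ)
    (hg : ∀ i, IsPolyDeg (kk i) (g i)) (hgtop : ∀ i, HasTopDeg (kk i) (g i))
    (dK : ℕ) (hdK : dK = Finset.univ.sup kk)
    (d : ℕ) (hd : dK ≤ d)
    (y : MIdx n → MIdx n → ℂ) (hy : HermArr n d y)
    (hball : (∃ Rv : Fin n → ℝ, (∀ j, 0 ≤ Rv j) ∧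
        ∀ j : Fin n, ∃ i : Fin m, g i = coordPoly n j (Rv j)) ∨
      (∃ R : ℝ, 0 ≤ R ∧ ∃ i : Fin m, g i = spherePoly n R)) :
    ((∃ (zs : Fin ((momMatrixId n (d - dK) y).rank) → (Fin n → ℂ))
        (lam : Fin ((momMatrixId n (d - dK) y).rank) → ℝ),
        AtomicRep n m d g y zs lam) ↔
      ((momMatrixId n d y).PosSemidef ∧
        (∀ i, (momMatrix n (d - kk i) (g i) y).PosSemidef) ∧
        (momMatrixId n d y).rank = (momMatrixId n (d - dK) y).rank ∧
        ∀ i j : Fin n, i < j → (locMat3 n (d - dK) y i j).PosSemidef)) ∧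
    (∀ (zs : Fin ((momMatrixId n (d - dK) y).rank) → (Fin n → ℂ))
        (lam : Fin ((momMatrixId n (d - dK) y).rank) → ℝ),
        AtomicRep n m d g y zs lam →
        ∀ i : Fin m, {j | peval (g i) (zs j) = 0}.ncard =
          (momMatrixId n d y).rank - (momMatrix n (d - dK) (g i) y).rank) := by
  subst hdK
  set e := d - Finset.univ.sup kk with he
  have hball' : ∀ i : Fin n, ∃ (i0 : Fin m) (a : ℂ) (J : Finset (Fin n)), i ∈ J ∧
      ∀ γ δ, g i0 γ δ = (if γ = 0 ∧ δ = 0 then a else 0) +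
        ∑ j ∈ J, if γ = Pi.single j 1 ∧ δ = Pi.single j 1 then -1 else 0 := by
    intro i
    rcases hball with ⟨Rv, _, h⟩ | ⟨R, _, i0, h⟩
    · obtain ⟨i0, h⟩ := h i
      exact ⟨i0, _, {i}, by simp, fun γ δ => by rw [h]; exact coord_ball i (Rv i) γ δ⟩
    · exact ⟨i0, _, Finset.univ, by simp, fun γ δ => by rw [h]; exact sphere_ball R γ δ⟩
  choose i0 a J hJ hgJ using hball'
  have hkk : ∀ i, kk (i0 i) = 1 := fun i => ball_deg (hg _) (hgtop _) (hJ i) (hgJ i)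
  have hle : ∀ i, kk i ≤ Finset.univ.sup kk := fun i => Finset.le_sup (Finset.mem_univ i)
  have h1 : 1 ≤ Finset.univ.sup kk := by
    rw [← hkk ⟨0, by omega⟩]; exact hle _
  have he1 : e + 1 ≤ d := by omega
  have hek : ∀ i, e + kk i ≤ d := fun i => by have := hle i; omega
  refine ⟨⟨?_, ?_⟩, ?_⟩
  · rintro ⟨zs, lam, hinj, hK, hl, hrep⟩
    refine ⟨?_, ?_, ?_, ?_⟩
    · rw [momMatrixId_rep zs lam hrep le_rfl]
      exact psd_of_rep _ _ fun j => (hl j).le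
    · intro i
      rw [momMatrix_rep (hg i) zs lam hrep (by have := hek i; omega)]
      exact psd_of_rep _ _ fun j => mul_nonneg (hl j).le (hK j i)
    · exact rank_top_rep zs lam hrep (by omega) rfl
    · intro i j _
      exact loc_psd zs lam hl hrep he1 i j
  · rintro ⟨hpsd, hpsdg, hrank, hloc⟩
    obtain ⟨W, u, hfr, hu, hspan⟩ := gns (by omega : e ≤ d) y hpsd hrank
    have hcore := back_all hn g kk i0 a J hJ hgJ hkk y u hu he1 hspan hpsdg hloc
    rw [hfr] at hcore
    obtain ⟨zs, lam, hinj, hl, hrep⟩ := hcore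
    have hrep' : ∀ α β : MIdx n, mdeg α ≤ d → mdeg β ≤ d →
        y α β = ∑ j, (lam j : ℂ) * (starRingEnd ℂ) (mpow (zs j) α) * mpow (zs j) β :=
      fun α β hα hβ => (hu α β hα hβ).symm.trans (hrep α β hα hβ)
    exact ⟨zs, lam, hinj, fun j i =>
      peval_nonneg_of_psd (hg i) zs lam hl hrep' (hek i) rfl (hpsdg i) j, hl, hrep'⟩
  · rintro zs lam ⟨hinj, hK, hl, hrep⟩ i
    exact zero_count (hg i) zs lam hl hrep (hek i) rfl
end
end

section
/- Assume z^opt ∈ K is a global solution, i.e., f(z^opt) = f^opt, and σ₀^opt, …, σ_m^opt ∈ Σ[z] satisfy f − f^opt = Σ_{i=0}^m σ_i^opt g_i identically on ℂⁿ. Define φ : ℂⁿ × Σ[z]^m → ℝ by φ(z, σ) := f(z) − Σ_{i=1}^m σ_i(z) g_i(z). Then (z^opt, σ₁^opt, …, σ_m^opt) is a saddle point of φ: φ(z^opt, σ) ≤ φ(z^opt, σ^opt) ≤ φ(z, σ^opt) for every z ∈ ℂⁿ and every σ = (σ₁,…,σ_m) ∈ Σ[z]^m. -/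
open scoped BigOperators ComplexOrder
open Classical Filter

noncomputable section

/-- Saddle point property: if `z^opt` is a global solution and
`f − f^opt = Σ_{i=0}^m σ_i^opt g_i` is a sum-of-squares certificate, then
`(z^opt, σ₁^opt, …, σ_m^opt)` is a saddle point of
`φ(z,σ) = f(z) − Σ_{i=1}^m σ_i(z) g_i(z)`. -/
theorem stmt15 (n m : ℕ) (f : MIdx n → MIdx n → ℂ)
    (g : Fin m → MIdx n → MIdx n → ℂ)
    (hf : ∃ l, IsPolyDeg l f) (hg : ∀ i, ∃ l, IsPolyDeg l (g i))
    (zopt : Fin n → ℂ) (hzK : zopt ∈ Kset g)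
    (hglob : ∀ z ∈ Kset g, peval f zopt ≤ peval f z)
    (σ0 : (Fin n → ℂ) → ℝ) (σ : Fin m → (Fin n → ℂ) → ℝ)
    (hσ0 : IsSOS σ0) (hσ : ∀ i, IsSOS (σ i))
    (hid : ∀ z, peval f z - peval f zopt = σ0 z + ∑ i, σ i z * peval (g i) z) :
    (∀ σ' : Fin m → (Fin n → ℂ) → ℝ, (∀ i, IsSOS (σ' i)) →
      peval f zopt - ∑ i, σ' i zopt * peval (g i) zopt ≤
        peval f zopt - ∑ i, σ i zopt * peval (g i) zopt) ∧
    (∀ z : Fin n → ℂ,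
      peval f zopt - ∑ i, σ i zopt * peval (g i) zopt ≤
        peval f z - ∑ i, σ i z * peval (g i) z) := by
  have nn : ∀ s : (Fin n → ℂ) → ℝ, IsSOS s → ∀ z, 0 ≤ s z := by
    rintro s ⟨d, r, p, -, h⟩ z
    rw [h]
    exact Finset.sum_nonneg fun j _ => Complex.normSq_nonneg _
  have hS : ∀ σ' : Fin m → (Fin n → ℂ) → ℝ, (∀ i, IsSOS (σ' i)) →
      0 ≤ ∑ i, σ' i zopt * peval (g i) zopt := fun σ' h =>
    Finset.sum_nonneg fun i _ => mul_nonneg (nn _ (h i) _) (hzK i)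
  have h1 := hS σ hσ
  have h2 := hid zopt
  have h3 := nn _ hσ0 zopt
  refine ⟨fun σ' h => ?_, fun z => ?_⟩
  · have := hS σ' h
    linarith
  · have := hid z
    have := nn _ hσ0 z
    linarith
end
end

section
/- Assume z^opt ∈ K is a global solution, i.e., f(z^opt) = f^opt, and σ₀^opt, …, σ_m^opt ∈ Σ[z] satisfy f − f^opt = Σ_{i=0}^m σ_i^opt g_i identically on ℂⁿ. Then the Karush–Kuhn–Tucker conditions hold with the sum-of-squares multipliers evaluated at z^opt: ∇f(z^opt) = Σ_{i=1}^m σ_i^opt(z^opt) ∇g_i(z^opt); σ_i^opt(z^opt) ≥ 0 and g_i(z^opt) ≥ 0 for i = 1,…,m; and σ_i^opt(z^opt) g_i(z^opt) = 0 for i = 1,…,m. -/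
open scoped BigOperators ComplexOrder
open Classical Filter

noncomputable section

/-- The Wirtinger gradient `∇φ(z) = ½(∇_x φ̃ − i ∇_y φ̃)` of a real-valued function of
several complex variables. -/
def wgrad {n : ℕ} (φ : (Fin n → ℂ) → ℝ) (z : Fin n → ℂ) : Fin n → ℂ := fun j =>
  (1 / 2 : ℂ) * (((fderiv ℝ φ z) (Pi.single j (1 : ℂ)) : ℂ) -
    Complex.I * ((fderiv ℝ φ z) (Pi.single j Complex.I) : ℂ))

theorem finite_mdeg (n l : ℕ) : {α : MIdx n | mdeg α ≤ l}.Finite := by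
  apply (Set.finite_Iic (fun _ : Fin n => l)).subset
  intro α hα i
  exact le_trans (Finset.single_le_sum (f := α) (fun j _ => Nat.zero_le _) (Finset.mem_univ i)) hα

theorem diff_mpow {n : ℕ} (α : MIdx n) : Differentiable ℝ (fun z : Fin n → ℂ => mpow z α) := by
  unfold mpow
  fun_prop

theorem diff_peval {n l : ℕ} (c : MIdx n → MIdx n → ℂ) (h : IsPolyDeg l c) :
    Differentiable ℝ (peval c) := by
  have e : peval c = fun z => Complex.reCLM (∑ α ∈ (finite_mdeg n l).toFinset,
      ∑ β ∈ (finite_mdeg n l).toFinset, c α β * Complex.conjCLE (mpow z α) * mpow z β) := by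
    funext z
    have h1 : ∀ α, ∑ᶠ β : MIdx n, c α β * (starRingEnd ℂ) (mpow z α) * mpow z β =
        ∑ β ∈ (finite_mdeg n l).toFinset, c α β * (starRingEnd ℂ) (mpow z α) * mpow z β := by
      intro α
      apply finsum_eq_sum_of_support_subset
      intro β hβ
      simp only [Set.Finite.coe_toFinset, Set.mem_setOf_eq]
      refine (h.1 α β ?_).2
      intro h0
      simp [h0] at hβ
    unfold peval
    simp only [h1]
    rw [finsum_eq_sum_of_support_subset (s := (finite_mdeg n l).toFinset)]
    · rfl
    · intro α hα
      simp only [Set.Finite.coe_toFinset, Set.mem_setOf_eq]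
      by_contra hc
      apply hα
      apply Finset.sum_eq_zero
      intro β _
      have : c α β = 0 := by
        by_contra h0
        exact hc (h.1 α β h0).1
      simp [this]
  rw [e]
  have := @diff_mpow n
  fun_prop

theorem diff_hpeval {n d : ℕ} (p : MIdx n → ℂ) (h : ∀ α, p α ≠ 0 → mdeg α ≤ d) :
    Differentiable ℝ (hpeval p) := by
  have e : hpeval p = fun z => ∑ α ∈ (finite_mdeg n d).toFinset, p α * mpow z α := by
    funext z
    apply finsum_eq_sum_of_support_subset
    intro α hα
    simp only [Set.Finite.coe_toFinset, Set.mem_setOf_eq]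
    refine h α ?_
    intro h0
    simp [h0] at hα
  rw [e]
  have := @diff_mpow n
  fun_prop

theorem sos_nonneg {n : ℕ} {σ : (Fin n → ℂ) → ℝ} (h : IsSOS σ) (z : Fin n → ℂ) : 0 ≤ σ z := by
  obtain ⟨d, r, p, _, h⟩ := h
  rw [h]
  exact Finset.sum_nonneg fun j _ => Complex.normSq_nonneg _

theorem sos_diff {n : ℕ} {σ : (Fin n → ℂ) → ℝ} (h : IsSOS σ) : Differentiable ℝ σ := by
  obtain ⟨d, r, p, hp, h⟩ := h
  have e : σ = fun z => ∑ j, (Complex.reCLM (hpeval (p j) z) * Complex.reCLM (hpeval (p j) z)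
      + Complex.imCLM (hpeval (p j) z) * Complex.imCLM (hpeval (p j) z)) := by
    funext z
    rw [h]
    rfl
  rw [e]
  have := fun j => diff_hpeval (p j) (hp j)
  fun_prop

theorem sos_fderiv {n : ℕ} {σ : (Fin n → ℂ) → ℝ} (h : IsSOS σ) (z : Fin n → ℂ) (hz : σ z = 0) :
    fderiv ℝ σ z = 0 := by
  apply IsLocalMin.fderiv_eq_zero
  apply Filter.Eventually.of_forall
  intro w
  rw [hz]
  exact sos_nonneg h w

/-- Karush–Kuhn–Tucker conditions with sum-of-squares multipliers: if `z^opt` is a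
global solution and `f − f^opt = Σ_{i=0}^m σ_i^opt g_i` with `σ_i^opt ∈ Σ[z]`, then
`∇f(z^opt) = Σ_i σ_i^opt(z^opt) ∇g_i(z^opt)`, together with nonnegativity and
complementarity at `z^opt`. -/
theorem stmt16 (n m : ℕ) (f : MIdx n → MIdx n → ℂ)
    (g : Fin m → MIdx n → MIdx n → ℂ)
    (hf : ∃ l, IsPolyDeg l f) (hg : ∀ i, ∃ l, IsPolyDeg l (g i))
    (zopt : Fin n → ℂ) (hzK : zopt ∈ Kset g)
    (hglob : ∀ z ∈ Kset g, peval f zopt ≤ peval f z)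
    (σ0 : (Fin n → ℂ) → ℝ) (σ : Fin m → (Fin n → ℂ) → ℝ)
    (hσ0 : IsSOS σ0) (hσ : ∀ i, IsSOS (σ i))
    (hid : ∀ z, peval f z - peval f zopt = σ0 z + ∑ i, σ i z * peval (g i) z) :
    (wgrad (peval f) zopt =
      fun j => ∑ i, (σ i zopt : ℂ) * wgrad (peval (g i)) zopt j) ∧
    (∀ i, 0 ≤ σ i zopt) ∧ (∀ i, 0 ≤ peval (g i) zopt) ∧
    (∀ i, σ i zopt * peval (g i) zopt = 0) := by
  have hgz : ∀ i, 0 ≤ peval (g i) zopt := hzK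
  have hs : ∀ i, 0 ≤ σ i zopt := fun i => sos_nonneg (hσ i) zopt
  have ht : ∀ i ∈ Finset.univ, 0 ≤ σ i zopt * peval (g i) zopt :=
    fun i _ => mul_nonneg (hs i) (hgz i)
  have h0 := hid zopt
  rw [sub_self] at h0
  have hσ0n := sos_nonneg hσ0 zopt
  have hsum := Finset.sum_nonneg ht
  have hcomp : ∀ i, σ i zopt * peval (g i) zopt = 0 := fun i =>
    (Finset.sum_eq_zero_iff_of_nonneg ht).1 (by linarith) i (Finset.mem_univ i)
  refine ⟨?_, hs, hgz, hcomp⟩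
  have hd0 := sos_fderiv hσ0 zopt (by linarith)
  have hgd : ∀ i, DifferentiableAt ℝ (peval (g i)) zopt := fun i => by
    obtain ⟨l, hl⟩ := hg i
    exact diff_peval _ hl zopt
  have hF : HasFDerivAt (peval f) (∑ i, σ i zopt • fderiv ℝ (peval (g i)) zopt) zopt := by
    have e : peval f = fun z => (σ0 z + ∑ i, σ i z * peval (g i) z) + peval f zopt := by
      funext z
      rw [← hid z]
      ring
    rw [e]
    have H := (((sos_diff hσ0) zopt).hasFDerivAt.add (HasFDerivAt.fun_sum (u := Finset.univ)
      fun i _ => ((sos_diff (hσ i)) zopt).hasFDerivAt.mul (hgd i).hasFDerivAt)).add_const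
      (peval f zopt)
    refine HasFDerivAt.congr_fderiv H ?_
    rw [hd0, zero_add]
    apply Finset.sum_congr rfl
    intro i _
    rcases mul_eq_zero.1 (hcomp i) with h | h
    · rw [sos_fderiv (hσ i) zopt h, smul_zero, add_zero]
    · rw [h, zero_smul, add_zero]
  funext j
  unfold wgrad
  rw [hF.fderiv]
  simp only [ContinuousLinearMap.sum_apply, ContinuousLinearMap.smul_apply, smul_eq_mul,
    Complex.ofReal_sum, Complex.ofReal_mul, Finset.mul_sum, ← Finset.sum_sub_distrib]
  apply Finset.sum_congr rfl
  intro i _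
  ring
end
end
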